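/- For each prime p let M_p be a finite p-group, and let Q = ∏_p M_p be the direct product over all primes, equipped with the product topology (each M_p discrete). Then for every m ∈ ℕ the subgroup Q^m is open in Q, and every subgroup of finite index in Q is open; that is, Q is strongly complete. -/

import Mathlib

/-- The abstract subgroup `G^m` generated by all `m`-th powers of elements of `G`. -/
def powerSubgroup (G : Type*) [Group G] (m : ℕ) : Subgroup G :=
  Subgroup.closure {x : G | ∃ g : G, g ^ m = x}

theorem pow_mem_powerSubgroup {G : Type*} [Group G] (m : ℕ) (g : G) :
    g ^ m ∈ powerSubgroup G m :=
  Subgroup.subset_closure ⟨g, rfl⟩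

/-- In a product of `p`-groups over distinct primes, an element that is trivial at every prime
dividing `m` is an `m`-th power. -/
theorem exists_pow_eq_of_forall_dvd_eq_one
    {M : Nat.Primes → Type*} [∀ p, Group (M p)]
    (hM : ∀ p : Nat.Primes, IsPGroup (p : ℕ) (M p)) (m : ℕ)
    (x : (p : Nat.Primes) → M p) (hx : ∀ p : Nat.Primes, (p : ℕ) ∣ m → x p = 1) :
    ∃ g : (p : Nat.Primes) → M p, g ^ m = x := by
  have root (p : Nat.Primes) : ∃ y : M p, y ^ m = x p := by
    by_cases hp : (p : ℕ) ∣ m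
    · exact ⟨1, by rw [one_pow, hx p hp]⟩
    · exact ((hM p).powEquiv ((p.2.coprime_iff_not_dvd).2 hp)).surjective (x p)
  choose g hg using root
  exact ⟨g, funext hg⟩

theorem isOpen_powerSubgroup_prod_pGroups
    {M : Nat.Primes → Type*} [∀ p, Group (M p)]
    [∀ p, TopologicalSpace (M p)] [∀ p, DiscreteTopology (M p)]
    (hM : ∀ p : Nat.Primes, IsPGroup (p : ℕ) (M p)) {m : ℕ} (hm : 0 < m) :
    IsOpen (powerSubgroup ((p : Nat.Primes) → M p) m : Set ((p : Nat.Primes) → M p)) := by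
  have hfin : {p : Nat.Primes | (p : ℕ) ∣ m}.Finite :=
    ((Set.finite_Iic m).preimage Subtype.val_injective.injOn).subset
      fun p hp => Nat.le_of_dvd hm hp
  refine Subgroup.isOpen_of_mem_nhds _ (g := 1) (Filter.mem_of_superset
    ((isOpen_set_pi (s := fun p => ({1} : Set (M p))) hfin
      fun p _ => isOpen_discrete _).mem_nhds fun p _ => rfl) ?_)
  intro x hx
  obtain ⟨g, rfl⟩ := exists_pow_eq_of_forall_dvd_eq_one hM m x hx
  exact pow_mem_powerSubgroup m g

theorem exists_powerSubgroup_le_of_finiteIndex {G : Type*} [Group G] (H : Subgroup G)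
    [H.FiniteIndex] : ∃ m : ℕ, 0 < m ∧ powerSubgroup G m ≤ H := by
  refine ⟨H.normalCore.index, Nat.pos_of_ne_zero Subgroup.FiniteIndex.index_ne_zero, ?_⟩
  rw [powerSubgroup, Subgroup.closure_le]
  rintro _ ⟨g, rfl⟩
  exact H.normalCore_le (H.normalCore.pow_index_mem g)

/-- For each prime `p` let `M p` be a finite `p`-group, and let `Q = ∏ₚ M p` carry the
product topology (each factor discrete).  Then for every positive `m` the subgroup `Q^m`
is open in `Q`, and every finite-index subgroup of `Q` is open, i.e. `Q` is strongly
complete. -/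
theorem prod_pGroups_stronglyComplete
    (M : Nat.Primes → Type) [∀ p, Group (M p)] [∀ p, Fintype (M p)]
    [∀ p, TopologicalSpace (M p)] [∀ p, DiscreteTopology (M p)]
    (hM : ∀ p : Nat.Primes, IsPGroup (p : ℕ) (M p)) :
    (∀ m : ℕ, 0 < m →
      IsOpen ((powerSubgroup ((p : Nat.Primes) → M p) m : Subgroup _) :
        Set ((p : Nat.Primes) → M p))) ∧
    (∀ H : Subgroup ((p : Nat.Primes) → M p), H.FiniteIndex →
      IsOpen (H : Set ((p : Nat.Primes) → M p))) := by
  refine ⟨fun m hm => isOpen_powerSubgroup_prod_pGroups hM hm, fun H hH => ?_⟩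
  obtain ⟨m, hm, hle⟩ := exists_powerSubgroup_le_of_finiteIndex H
  exact Subgroup.isOpen_mono hle (isOpen_powerSubgroup_prod_pGroups hM hm)
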